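/- Assume each ℓ_j is convex, differentiable and G-Lipschitz, let 0 < r ≤ ε'/G, 0 < λ ≤ G/r, and let x, x' ∈ B_r(x̄) ∩ 𝒳. Draw i ∈ [M] with probability p_i(x') = e^{𝓛_i(x')/ε'}/Σ_{k∈[M]} e^{𝓛_k(x')/ε'}, then j ∈ [N] with probability w_{ij}, and (independently given i) form the MLMC estimator M̂[γ_i(x,x')]. With M̂c = (Σ_{k∈[M]} e^{𝓛_k(x')/ε'})/(Σ_{k∈[M]} e^{𝓛_k(x̄)/ε'}), ∇ℓ_j^λ(x) = ∇ℓ_j(x) + λ(x − x̄), and ĝ_{x'}(x) = ∇Γ_{ε,λ}(x') + (M̂c/ε')[ M̂[γ_i(x,x')] ∇ℓ_j^λ(x) − γ_i(x',x') ∇ℓ_j^λ(x') ], one has E[ĝ_{x'}(x)] = ∇Γ_{ε,λ}(x). -/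

import Mathlib

open Real

noncomputable section

/-- Group loss `𝓛_i(x) = Σ_j w_{ij} ℓ_j(x)`. -/
def groupLoss {d N M : ℕ} (w : Fin M → Fin N → ℝ)
    (ℓ : Fin N → EuclideanSpace ℝ (Fin d) → ℝ) (i : Fin M)
    (x : EuclideanSpace ℝ (Fin d)) : ℝ :=
  ∑ j, w i j * ℓ j x

/-- `γ̂(x,x'; s₁,…,sₙ)` evaluated on the first `n` terms of the sample sequence `s`. -/
def gammaHat {d N : ℕ} (ℓ : Fin N → EuclideanSpace ℝ (Fin d) → ℝ) (ε' lam : ℝ)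
    (xbar x x' : EuclideanSpace ℝ (Fin d)) (n : ℕ) (s : ℕ → Fin N) : ℝ :=
  ε' * Real.exp (((n : ℝ)⁻¹ * ∑ k ∈ Finset.range n, (ℓ (s k) x - ℓ (s k) x') +
      lam / 2 * ‖x - xbar‖ ^ 2) / ε')

/-- `D̂_{2m}`. -/
def dHat {d N : ℕ} (ℓ : Fin N → EuclideanSpace ℝ (Fin d) → ℝ) (ε' lam : ℝ)
    (xbar x x' : EuclideanSpace ℝ (Fin d)) (m : ℕ) (s : ℕ → Fin N) : ℝ :=
  gammaHat ℓ ε' lam xbar x x' (2 * m) s -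
    (gammaHat ℓ ε' lam xbar x x' m s + gammaHat ℓ ε' lam xbar x x' m (fun k => s (m + k))) / 2

/-- `p_j = (1 − 8^{−1/2}) 8^{−j/2}`. -/
def geomP (j : ℕ) : ℝ := (1 - (Real.sqrt 8)⁻¹) * ((Real.sqrt 8)⁻¹) ^ j

/-- MLMC estimator value at level `j`: `γ̂(x,x'; S₁) + D̂_{2^j}/p_j`, with `D̂_1 = 0`. -/
def mlmcVal {d N : ℕ} (ℓ : Fin N → EuclideanSpace ℝ (Fin d) → ℝ) (ε' lam : ℝ)
    (xbar x x' : EuclideanSpace ℝ (Fin d)) (j : ℕ) (s : ℕ → Fin N) : ℝ :=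
  gammaHat ℓ ε' lam xbar x x' 1 s +
    (if j = 0 then 0 else dHat ℓ ε' lam xbar x x' (2 ^ (j - 1)) s) / geomP j

/-- Extends a finite sample tuple to an infinite sequence. -/
def extSeq {N n : ℕ} (hn : 0 < n) (s : Fin n → Fin N) : ℕ → Fin N :=
  fun k => if h : k < n then s ⟨k, h⟩ else s ⟨0, hn⟩

/-- `j`-th term of the expectation of the vector-valued `f(J, S₁, S₂, …)`, `S ~ w_i` i.i.d. -/
def mlmcSummandVec {d N M : ℕ} (w : Fin M → Fin N → ℝ) (i : Fin M)
    (ℱ : ℕ → (ℕ → Fin N) → EuclideanSpace ℝ (Fin d)) (j : ℕ) :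
    EuclideanSpace ℝ (Fin d) :=
  geomP j • ∑ s : Fin (2 ^ j) → Fin N,
    (∏ k, w i (s k)) • ℱ j (extSeq (Nat.two_pow_pos j) s)


def phiPow {N : ℕ} (v y : Fin N → ℝ) (m : ℕ) : ℝ :=
  (∑ j, v j * Real.exp ((m : ℝ)⁻¹ * y j)) ^ m

lemma sum_prod_window {N : ℕ} (v y : Fin N → ℝ) (hv1 : ∑ j, v j = 1) (n o m : ℕ) (hn : 0 < n)
    (hom : o + m ≤ n) :
    ∑ s : Fin n → Fin N, (∏ k, v (s k)) *
      Real.exp ((m : ℝ)⁻¹ * ∑ k ∈ Finset.range m, y (extSeq hn s (o + k))) = phiPow v y m := by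
  have key : ∀ s : Fin n → Fin N, (∏ k, v (s k)) *
      Real.exp ((m : ℝ)⁻¹ * ∑ k ∈ Finset.range m, y (extSeq hn s (o + k))) =
      ∏ k : Fin n, (v (s k) * (if o ≤ k.1 ∧ k.1 < o + m then
        Real.exp ((m : ℝ)⁻¹ * y (s k)) else 1)) := by
    intro s
    rw [Finset.prod_mul_distrib, Finset.mul_sum, Real.exp_sum]
    congr 1
    rw [← Finset.prod_filter]
    symm
    refine Finset.prod_bij (fun k _ => k.1 - o) ?_ ?_ ?_ ?_
    · intro k hk
      simp at hk ⊢
      omega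
    · intro a ha b hb h
      simp at ha hb h
      ext
      omega
    · intro b hb
      simp at hb
      refine ⟨⟨o + b, by omega⟩, ?_, ?_⟩
      · simp; omega
      · simp
    · intro k hk
      simp at hk
      have : o + (k.1 - o) = k.1 := by omega
      simp [extSeq, this]
  rw [Finset.sum_congr rfl (fun s _ => key s)]
  have h2 := (Finset.prod_univ_sum (fun _ : Fin n => (Finset.univ : Finset (Fin N)))
    (fun k j => v j * (if o ≤ k.1 ∧ k.1 < o + m then
        Real.exp ((m : ℝ)⁻¹ * y j) else 1))).symm
  rw [Fintype.piFinset_univ] at h2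
  rw [h2]
  have h3 : ∀ k : Fin n, ∑ j, v j * (if o ≤ k.1 ∧ k.1 < o + m then
        Real.exp ((m : ℝ)⁻¹ * y j) else 1) = if o ≤ k.1 ∧ k.1 < o + m then
        ∑ j, v j * Real.exp ((m : ℝ)⁻¹ * y j) else 1 := by
    intro k
    split_ifs <;> simp [hv1]
  rw [Finset.prod_congr rfl (fun k _ => h3 k), ← Finset.prod_filter, Finset.prod_const, phiPow]
  congr 1
  have : Finset.card (Finset.filter (fun k : Fin n => o ≤ k.1 ∧ k.1 < o + m) Finset.univ)
      = Finset.card (Finset.range m) := by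
    refine Finset.card_bij (fun k _ => k.1 - o) ?_ ?_ ?_
    · intro k hk
      simp at hk ⊢
      omega
    · intro a ha b hb h
      simp at ha hb h
      ext
      omega
    · intro b hb
      simp at hb
      refine ⟨⟨o + b, by omega⟩, ?_, ?_⟩
      · simp; omega
      · simp
  simpa using this

lemma phiPow_nonneg {N : ℕ} (v y : Fin N → ℝ) (hv : ∀ j, 0 ≤ v j) (m : ℕ) :
    0 ≤ phiPow v y m :=
  pow_nonneg (Finset.sum_nonneg fun j _ => mul_nonneg (hv j) (Real.exp_pos _).le) _

lemma phiPow_anti {N : ℕ} (v y : Fin N → ℝ) (hv : ∀ j, 0 ≤ v j) (hv1 : ∑ j, v j = 1) (m : ℕ)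
    (hm : 0 < m) : phiPow v y (2 * m) ≤ phiPow v y m := by
  unfold phiPow
  rw [pow_mul]
  have hm' : (m : ℝ) ≠ 0 := by positivity
  refine pow_le_pow_left₀ (by positivity) ?_ _
  refine (Real.pow_arith_mean_le_arith_mean_pow Finset.univ v _ (fun j _ => hv j) hv1
    (fun j _ => (Real.exp_pos _).le) 2).trans (le_of_eq ?_)
  refine Finset.sum_congr rfl fun j _ => ?_
  rw [← Real.exp_nat_mul]
  congr 2
  push_cast
  field_simp

lemma phiPow_tendsto {N : ℕ} (v y : Fin N → ℝ) (hv1 : ∑ j, v j = 1) :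
    Filter.Tendsto (phiPow v y) Filter.atTop (nhds (Real.exp (∑ j, v j * y j))) := by
  have hd : HasDerivAt (fun t : ℝ => ∑ j, v j * Real.exp (t * y j)) (∑ j, v j * y j) 0 := by
    have : ∀ j ∈ Finset.univ, HasDerivAt (fun t : ℝ => v j * Real.exp (t * y j)) (v j * y j) 0 := by
      intro j _
      have := (((hasDerivAt_id (0:ℝ)).mul_const (y j)).exp).const_mul (v j)
      simpa using this
    exact HasDerivAt.fun_sum this
  have hs := hd.tendsto_slope_zero
  have h1 : Filter.Tendsto (fun n : ℕ => (n : ℝ)⁻¹) Filter.atTop (nhdsWithin 0 {0}ᶜ) := by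
    rw [tendsto_nhdsWithin_iff]
    refine ⟨tendsto_inv_atTop_nhds_zero_nat, ?_⟩
    filter_upwards [Filter.eventually_gt_atTop 0] with n hn
    simp; omega
  have h2 := hs.comp h1
  have h3 : Filter.Tendsto (fun n : ℕ => (n : ℝ) * ((∑ j, v j * Real.exp ((n : ℝ)⁻¹ * y j)) - 1))
      Filter.atTop (nhds (∑ j, v j * y j)) := by
    refine h2.congr fun n => ?_
    simp [hv1]
  have h4 := Real.tendsto_one_add_pow_exp_of_tendsto h3
  refine h4.congr fun n => ?_
  simp [phiPow]

lemma telescope_hasSum (a : ℕ → ℝ) (L : ℝ) (ha : ∀ k, a (k + 1) ≤ a k)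
    (hL : Filter.Tendsto a Filter.atTop (nhds L)) :
    HasSum (fun k => if k = 0 then 0 else a k - a (k - 1)) (L - a 0) := by
  have h : HasSum (fun k => a k - a (k + 1)) (a 0 - L) := by
    rw [hasSum_iff_tendsto_nat_of_nonneg (fun k => sub_nonneg.2 (ha k))]
    simp only [Finset.sum_range_sub']
    exact hL.const_sub _
  rw [← hasSum_nat_add_iff' 1]
  simpa using h.neg

lemma geomP_pos (k : ℕ) : 0 < geomP k := by
  unfold geomP
  have h : (1:ℝ) < Real.sqrt 8 := by
    rw [Real.lt_sqrt] <;> norm_num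
  have := inv_lt_one_of_one_lt₀ h
  have h2 : 0 < (Real.sqrt 8)⁻¹ := by positivity
  exact mul_pos (by linarith) (pow_pos h2 _)

lemma geomP_hasSum : HasSum geomP 1 := by
  have h : (1:ℝ) < Real.sqrt 8 := by
    rw [Real.lt_sqrt] <;> norm_num
  have := inv_lt_one_of_one_lt₀ h
  have h2 : 0 < (Real.sqrt 8)⁻¹ := by positivity
  have h3 := (hasSum_geometric_of_lt_one h2.le this).mul_left (1 - (Real.sqrt 8)⁻¹)
  rw [mul_inv_cancel₀ (by linarith)] at h3
  exact h3

lemma sum_gammaHat {d N : ℕ} (ℓ : Fin N → EuclideanSpace ℝ (Fin d) → ℝ) (ε' lam : ℝ)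
    (xbar x x' : EuclideanSpace ℝ (Fin d)) (v : Fin N → ℝ) (hv1 : ∑ j, v j = 1)
    (n o m : ℕ) (hn : 0 < n) (hom : o + m ≤ n) :
    ∑ s : Fin n → Fin N, (∏ k, v (s k)) *
      gammaHat ℓ ε' lam xbar x x' m (fun k => extSeq hn s (o + k)) =
    (ε' * Real.exp (lam / 2 * ‖x - xbar‖ ^ 2 / ε')) *
      phiPow v (fun j => (ℓ j x - ℓ j x') / ε') m := by
  rw [← sum_prod_window v _ hv1 n o m hn hom, Finset.mul_sum]
  refine Finset.sum_congr rfl fun s _ => ?_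
  unfold gammaHat
  rw [add_div, Real.exp_add, mul_div_assoc, Finset.sum_div]
  ring

lemma mlmc_expect {d N : ℕ} (ℓ : Fin N → EuclideanSpace ℝ (Fin d) → ℝ) (ε' lam : ℝ)
    (xbar x x' : EuclideanSpace ℝ (Fin d)) (v : Fin N → ℝ) (hv1 : ∑ j, v j = 1) (k : ℕ) :
    geomP k * ∑ s : Fin (2 ^ k) → Fin N, (∏ q, v (s q)) *
      mlmcVal ℓ ε' lam xbar x x' k (extSeq (Nat.two_pow_pos k) s) =
    (ε' * Real.exp (lam / 2 * ‖x - xbar‖ ^ 2 / ε')) *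
      (geomP k * phiPow v (fun j => (ℓ j x - ℓ j x') / ε') 1 +
       if k = 0 then 0 else phiPow v (fun j => (ℓ j x - ℓ j x') / ε') (2 ^ k) -
          phiPow v (fun j => (ℓ j x - ℓ j x') / ε') (2 ^ (k - 1))) := by
  have hg := (geomP_pos k).ne'
  have H := fun o m => sum_gammaHat ℓ ε' lam xbar x x' v hv1 (2 ^ k) o m (Nat.two_pow_pos k)
  have h1 := H 0 1 (by have := Nat.two_pow_pos k; omega)
  simp only [zero_add] at h1
  rcases k with _ | k
  · simp only [mlmcVal, if_true, zero_div, add_zero]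
    rw [h1]
    ring
  · have h2 := H 0 (2 ^ (k + 1)) (by omega)
    have h3 := H 0 (2 ^ k) (by rw [pow_succ]; omega)
    have h4 := H (2 ^ k) (2 ^ k) (by rw [pow_succ]; omega)
    simp only [zero_add] at h2 h3
    have e : 2 * 2 ^ k = 2 ^ (k + 1) := by ring
    simp only [mlmcVal, dHat, Nat.add_sub_cancel, Nat.succ_ne_zero, if_false, e]
    have : ∀ s : Fin (2 ^ (k + 1)) → Fin N, ∀ a b c f : ℝ, (∏ q, v (s q)) *
        (a + (b - (c + f) / 2) / geomP (k + 1)) =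
        (∏ q, v (s q)) * a + (geomP (k + 1))⁻¹ * ((∏ q, v (s q)) * b)
          - (geomP (k + 1))⁻¹ / 2 * ((∏ q, v (s q)) * c)
          - (geomP (k + 1))⁻¹ / 2 * ((∏ q, v (s q)) * f) := by
      intros; ring
    simp only [this, Finset.sum_add_distrib, Finset.sum_sub_distrib, ← Finset.mul_sum]
    rw [h1, h2, h3, h4]
    field_simp
    ring

lemma mlmc_hasSum {d N : ℕ} (ℓ : Fin N → EuclideanSpace ℝ (Fin d) → ℝ) (ε' lam : ℝ)
    (xbar x x' : EuclideanSpace ℝ (Fin d)) (v : Fin N → ℝ) (hv : ∀ j, 0 ≤ v j)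
    (hv1 : ∑ j, v j = 1) :
    HasSum (fun k => geomP k * ∑ s : Fin (2 ^ k) → Fin N, (∏ q, v (s q)) *
      mlmcVal ℓ ε' lam xbar x x' k (extSeq (Nat.two_pow_pos k) s))
    ((ε' * Real.exp (lam / 2 * ‖x - xbar‖ ^ 2 / ε')) *
      Real.exp (∑ j, v j * ((ℓ j x - ℓ j x') / ε'))) := by
  simp only [mlmc_expect ℓ ε' lam xbar x x' v hv1]
  refine HasSum.mul_left _ ?_
  set y : Fin N → ℝ := fun j => (ℓ j x - ℓ j x') / ε'
  have h1 := geomP_hasSum.mul_right (phiPow v y 1)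
  have h2 := telescope_hasSum (fun k => phiPow v y (2 ^ k)) (Real.exp (∑ j, v j * y j))
    (fun k => by
      have := phiPow_anti v y hv hv1 (2 ^ k) (by positivity)
      rwa [show 2 * 2 ^ k = 2 ^ (k + 1) by ring] at this)
    ((phiPow_tendsto v y hv1).comp (tendsto_pow_atTop_atTop_of_one_lt (by norm_num)))
  convert h1.add h2 using 1
  simp [y]

lemma sum_prod_eq_one {N : ℕ} (v : Fin N → ℝ) (hv1 : ∑ j, v j = 1) (n : ℕ) :
    ∑ s : Fin n → Fin N, ∏ k, v (s k) = 1 := by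
  have h2 := (Finset.prod_univ_sum (fun _ : Fin n => (Finset.univ : Finset (Fin N)))
    (fun _ j => v j)).symm
  rw [Fintype.piFinset_univ] at h2
  rw [h2]
  simp [hv1]

lemma summandVec_hasSum {d N M : ℕ} (ℓ : Fin N → EuclideanSpace ℝ (Fin d) → ℝ) (ε' lam : ℝ)
    (xbar x x' : EuclideanSpace ℝ (Fin d)) (w : Fin M → Fin N → ℝ) (i : Fin M)
    (hw : w i ∈ stdSimplex ℝ (Fin N)) (V U W : EuclideanSpace ℝ (Fin d)) (c b : ℝ) :
    HasSum (mlmcSummandVec w i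
      (fun k s => V + c • (mlmcVal ℓ ε' lam xbar x x' k s • U - b • W)))
    (V + c • (((ε' * Real.exp (lam / 2 * ‖x - xbar‖ ^ 2 / ε')) *
      Real.exp (∑ j, w i j * ((ℓ j x - ℓ j x') / ε'))) • U - b • W)) := by
  have h1 := geomP_hasSum.smul_const (V - (c * b) • W)
  have h2 := (mlmc_hasSum ℓ ε' lam xbar x x' (w i) hw.1 hw.2).smul_const (c • U)
  convert h1.add h2 using 1
  · funext k
    unfold mlmcSummandVec
    have : ∀ s : Fin (2 ^ k) → Fin N, ∀ a : ℝ,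
        (∏ q, w i (s q)) • (V + c • (a • U - b • W)) =
        (∏ q, w i (s q)) • (V - (c * b) • W) + ((∏ q, w i (s q)) * a) • (c • U) := by
      intros; module
    simp only [this, Finset.sum_add_distrib, ← Finset.sum_smul, sum_prod_eq_one (w i) hw.2]
    module
  · module

lemma gamma_hasGradient {d N M : ℕ} (ℓ : Fin N → EuclideanSpace ℝ (Fin d) → ℝ)
    (gradℓ : Fin N → EuclideanSpace ℝ (Fin d) → EuclideanSpace ℝ (Fin d))
    (w : Fin M → Fin N → ℝ) (ε' lam : ℝ) (hε : ε' ≠ 0)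
    (hdiff : ∀ j z, HasGradientAt (ℓ j) (gradℓ j z) z)
    (xbar : EuclideanSpace ℝ (Fin d)) (p : Fin M → ℝ) (z : EuclideanSpace ℝ (Fin d)) :
    HasGradientAt (fun z => ∑ i, p i * (ε' * Real.exp ((groupLoss w ℓ i z - groupLoss w ℓ i xbar
        + lam / 2 * ‖z - xbar‖ ^ 2) / ε')))
      (∑ i, p i • (((ε' * Real.exp ((groupLoss w ℓ i z - groupLoss w ℓ i xbar
        + lam / 2 * ‖z - xbar‖ ^ 2) / ε')) / ε') •
        ((∑ j, w i j • gradℓ j z) + lam • (z - xbar)))) z := by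
  rw [hasGradientAt_iff_hasFDerivAt]
  have hg : ∀ i, HasFDerivAt (groupLoss w ℓ i)
      (∑ j, w i j • InnerProductSpace.toDual ℝ _ (gradℓ j z)) z := by
    intro i
    exact HasFDerivAt.fun_sum fun j _ => (hdiff j z).hasFDerivAt.const_mul (w i j)
  have hn : HasFDerivAt (fun z : EuclideanSpace ℝ (Fin d) => ‖z - xbar‖ ^ 2)
      (2 • innerSL ℝ (z - xbar)) z := by
    have := ((hasFDerivAt_id z).sub_const xbar).norm_sq
    simpa using this
  have := HasFDerivAt.fun_sum (u := Finset.univ) fun i _ =>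
    ((((((hg i).sub_const (groupLoss w ℓ i xbar)).add (hn.const_mul (lam / 2))).mul_const
      ε'⁻¹).exp.const_mul ε').const_mul (p i))
  simp only [← div_eq_mul_inv] at this
  refine this.congr_fderiv ?_
  ext u
  simp [InnerProductSpace.toDual_apply_apply, sum_inner, inner_add_left, inner_smul_left]
  refine Finset.sum_congr rfl fun i _ => ?_
  field_simp

/-- For convex, differentiable, `G`-Lipschitz losses, `0 < r ≤ ε'/G`,
`0 < λ ≤ G/r`, and `x, x' ∈ B_r(x̄) ∩ 𝒳`, the SVRG-like estimator
`ĝ_{x'}(x) = ∇Γ_{ε,λ}(x') + (M̂c/ε')[ M̂[γ_i(x,x')] ∇ℓ_j^λ(x) − γ_i(x',x') ∇ℓ_j^λ(x') ]`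
with `i ~ p(x')`, `j ~ w_i`, is unbiased: `E[ĝ_{x'}(x)] = ∇Γ_{ε,λ}(x)`. -/
theorem stmt5
    (d N M : ℕ) (hM : 2 ≤ M)
    (𝒳 : Set (EuclideanSpace ℝ (Fin d))) (hXconv : Convex ℝ 𝒳) (hXcl : IsClosed 𝒳)
    (ℓ : Fin N → EuclideanSpace ℝ (Fin d) → ℝ)
    (gradℓ : Fin N → EuclideanSpace ℝ (Fin d) → EuclideanSpace ℝ (Fin d))
    (w : Fin M → Fin N → ℝ) (hw : ∀ i, w i ∈ stdSimplex ℝ (Fin N))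
    (G ε ε' lam r : ℝ) (hG : 0 < G) (hε : 0 < ε)
    (hε' : ε' = ε / (2 * Real.log (M : ℝ)))
    (hconv : ∀ j, ConvexOn ℝ 𝒳 (ℓ j))
    (hdiff : ∀ j z, HasGradientAt (ℓ j) (gradℓ j z) z)
    (hlip : ∀ j (z z' : EuclideanSpace ℝ (Fin d)), |ℓ j z - ℓ j z'| ≤ G * ‖z - z'‖)
    (hr : 0 < r) (hrε : r ≤ ε' / G) (hlam : 0 < lam) (hlamr : lam ≤ G / r)
    (xbar : EuclideanSpace ℝ (Fin d)) (hxbar : xbar ∈ 𝒳)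
    (x x' : EuclideanSpace ℝ (Fin d))
    (hx : x ∈ Metric.closedBall xbar r ∩ 𝒳) (hx' : x' ∈ Metric.closedBall xbar r ∩ 𝒳) :
    let pbar : Fin M → ℝ := fun i =>
      Real.exp (groupLoss w ℓ i xbar / ε') / ∑ k, Real.exp (groupLoss w ℓ k xbar / ε')
    let pX : Fin M → ℝ := fun i =>
      Real.exp (groupLoss w ℓ i x' / ε') / ∑ k, Real.exp (groupLoss w ℓ k x' / ε')
    let Mc : ℝ :=
      (∑ k, Real.exp (groupLoss w ℓ k x' / ε')) / ∑ k, Real.exp (groupLoss w ℓ k xbar / ε')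
    let γfun : Fin M → EuclideanSpace ℝ (Fin d) → ℝ := fun i z =>
      ε' * Real.exp ((groupLoss w ℓ i z - groupLoss w ℓ i xbar + lam / 2 * ‖z - xbar‖ ^ 2) / ε')
    let Γfun : EuclideanSpace ℝ (Fin d) → ℝ := fun z => ∑ i, pbar i * γfun i z
    let gradGamma : EuclideanSpace ℝ (Fin d) → EuclideanSpace ℝ (Fin d) := fun z =>
      ∑ i, pbar i • ((γfun i z / ε') •
        ((∑ j, w i j • gradℓ j z) + lam • (z - xbar)))
    let estVec : Fin M → Fin N → ℕ → (ℕ → Fin N) → EuclideanSpace ℝ (Fin d) :=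
      fun _i j k s =>
        gradGamma x' + (Mc / ε') •
          ((mlmcVal ℓ ε' lam xbar x x' k s) • (gradℓ j x + lam • (x - xbar)) -
            (ε' * Real.exp ((lam / 2 * ‖x' - xbar‖ ^ 2) / ε')) •
              (gradℓ j x' + lam • (x' - xbar)))
    HasGradientAt Γfun (gradGamma x') x' ∧
    (∀ i j, Summable (mlmcSummandVec w i (estVec i j))) ∧
    HasGradientAt Γfun (gradGamma x) x ∧
    (∑ i, pX i • ∑ j, w i j • ∑' k, mlmcSummandVec w i (estVec i j) k) = gradGamma x := by
  have hlog : 0 < Real.log (M : ℝ) := Real.log_pos (by exact_mod_cast (by omega : 1 < M))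
  have hεp : 0 < ε' := by rw [hε']; positivity
  have hε0 : ε' ≠ 0 := hεp.ne'
  intro pbar pX Mc γfun Γfun gradGamma estVec
  have hgrad : ∀ z, HasGradientAt Γfun (gradGamma z) z := fun z =>
    gamma_hasGradient ℓ gradℓ w ε' lam hε0 hdiff xbar pbar z
  have hs := fun i j => summandVec_hasSum ℓ ε' lam xbar x x' w i (hw i) (gradGamma x')
    (gradℓ j x + lam • (x - xbar)) (gradℓ j x' + lam • (x' - xbar)) (Mc / ε')
    (ε' * Real.exp ((lam / 2 * ‖x' - xbar‖ ^ 2) / ε'))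
  refine ⟨hgrad x', fun i j => (hs i j).summable, hgrad x, ?_⟩
  have ht : ∀ i j, ∑' k, mlmcSummandVec w i (estVec i j) k = _ := fun i j => (hs i j).tsum_eq
  simp only [ht]
  have : Nonempty (Fin M) := ⟨⟨0, by omega⟩⟩
  have hZ' : 0 < ∑ k, Real.exp (groupLoss w ℓ k x' / ε') :=
    Finset.sum_pos (fun k _ => Real.exp_pos _) Finset.univ_nonempty
  have hZ : 0 < ∑ k, Real.exp (groupLoss w ℓ k xbar / ε') :=
    Finset.sum_pos (fun k _ => Real.exp_pos _) Finset.univ_nonempty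
  have hp1 : ∑ i, pX i = 1 := by
    simp only [pX]
    rw [← Finset.sum_div, div_self hZ'.ne']
  have hgl : ∀ i, ∑ j, w i j * ((ℓ j x - ℓ j x') / ε') =
      (groupLoss w ℓ i x - groupLoss w ℓ i x') / ε' := by
    intro i
    simp only [groupLoss]
    rw [← Finset.sum_sub_distrib, Finset.sum_div]
    exact Finset.sum_congr rfl fun j _ => by ring
  have hinner : ∀ i (V : EuclideanSpace ℝ (Fin d)) (c a b : ℝ),
      ∑ j, w i j • (V + c • (a • (gradℓ j x + lam • (x - xbar)) -
        b • (gradℓ j x' + lam • (x' - xbar)))) =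
      V + (c * a) • ((∑ j, w i j • gradℓ j x) + lam • (x - xbar)) -
        (c * b) • ((∑ j, w i j • gradℓ j x') + lam • (x' - xbar)) := by
    intro i V c a b
    have : ∀ j, w i j • (V + c • (a • (gradℓ j x + lam • (x - xbar)) -
        b • (gradℓ j x' + lam • (x' - xbar)))) =
        w i j • (V + (c * a) • lam • (x - xbar) - (c * b) • lam • (x' - xbar)) +
        (c * a) • (w i j • gradℓ j x) - (c * b) • (w i j • gradℓ j x') := by
      intro j; module
    simp only [this, Finset.sum_add_distrib, Finset.sum_sub_distrib, ← Finset.sum_smul,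
      ← Finset.smul_sum, (hw i).2]
    module
  simp only [hinner, hgl]
  have hA : ∀ i, pX i * (Mc / ε' * (ε' * Real.exp (lam / 2 * ‖x - xbar‖ ^ 2 / ε') *
      Real.exp ((groupLoss w ℓ i x - groupLoss w ℓ i x') / ε'))) = pbar i * (γfun i x / ε') := by
    intro i
    simp only [pX, Mc, pbar, γfun]
    have e1 : Real.exp (groupLoss w ℓ i x' / ε') * (Real.exp (lam / 2 * ‖x - xbar‖ ^ 2 / ε') *
      Real.exp ((groupLoss w ℓ i x - groupLoss w ℓ i x') / ε')) =
      Real.exp (groupLoss w ℓ i xbar / ε') * Real.exp ((groupLoss w ℓ i x - groupLoss w ℓ i xbar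
        + lam / 2 * ‖x - xbar‖ ^ 2) / ε') := by
      simp only [← Real.exp_add]
      congr 1
      ring
    generalize Real.exp (lam / 2 * ‖x - xbar‖ ^ 2 / ε') = t1 at *
    generalize Real.exp ((groupLoss w ℓ i x - groupLoss w ℓ i x') / ε') = t2 at *
    generalize Real.exp ((groupLoss w ℓ i x - groupLoss w ℓ i xbar
        + lam / 2 * ‖x - xbar‖ ^ 2) / ε') = t3 at *
    generalize (∑ k, Real.exp (groupLoss w ℓ k x' / ε')) = Z' at *
    generalize (∑ k, Real.exp (groupLoss w ℓ k xbar / ε')) = Z at *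
    have := hZ.ne'
    have := hZ'.ne'
    field_simp
    linarith [e1]
  have hB : ∀ i, pX i * (Mc / ε' * (ε' * Real.exp ((lam / 2 * ‖x' - xbar‖ ^ 2) / ε'))) =
      pbar i * (γfun i x' / ε') := by
    intro i
    simp only [pX, Mc, pbar, γfun]
    have e1 : Real.exp (groupLoss w ℓ i x' / ε') * Real.exp (lam / 2 * ‖x' - xbar‖ ^ 2 / ε') =
      Real.exp (groupLoss w ℓ i xbar / ε') * Real.exp ((groupLoss w ℓ i x' - groupLoss w ℓ i xbar
        + lam / 2 * ‖x' - xbar‖ ^ 2) / ε') := by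
      simp only [← Real.exp_add]
      congr 1
      ring
    generalize Real.exp (lam / 2 * ‖x' - xbar‖ ^ 2 / ε') = t1 at *
    generalize Real.exp ((groupLoss w ℓ i x' - groupLoss w ℓ i xbar
        + lam / 2 * ‖x' - xbar‖ ^ 2) / ε') = t3 at *
    generalize (∑ k, Real.exp (groupLoss w ℓ k x' / ε')) = Z' at *
    generalize (∑ k, Real.exp (groupLoss w ℓ k xbar / ε')) = Z at *
    have := hZ.ne'
    have := hZ'.ne'
    field_simp
    linarith [e1]
  simp only [smul_sub (pX _), smul_add (pX _) (gradGamma x'), smul_smul (pX _), hA, hB]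
  rw [Finset.sum_sub_distrib, Finset.sum_add_distrib, ← Finset.sum_smul, hp1, one_smul]
  simp only [gradGamma, smul_smul]
  abel
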